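/- arXiv:1012.1587 — 2 statements merged into one kernel-verified Lean document; each statement's English description precedes it below -/
import Mathlib

section
/- For every n and all indices with 2 ≤ i ≤ j ≤ n, the identity u_j ∘ t_0 ∘ u_i ∘ t_0 = t_0 ∘ u_i ∘ t_0 ∘ u_{j+1} holds as maps [n+2] → [n] (each elementary map taken at the appropriate dimension; on the left the inner t_0 acts on [n+2] and the factor u_i is u_i^{(n+1)}, on the right u_{j+1} is u_{j+1}^{(n+1)} and the factor u_i is u_i^{(n)}). -/
/-- The elementary coface `d_i^{(n+1)} : [n] → [n+1]` (monotonic injection omitting `i`):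
`k ↦ k` for `k < i` and `k ↦ k+1` for `k ≥ i`. -/
def dMap (n i : ℕ) : Fin (n + 1) → Fin (n + 2) :=
  fun k => if (k : ℕ) < i then ⟨k, by omega⟩ else ⟨(k : ℕ) + 1, by omega⟩

/-- The elementary quasi-codegeneracy `u_i^{(n)} : [n+1] → [n]`:
`u_i 0 = u_i i = 0`, `u_i k = k` for `1 ≤ k ≤ i-1`, and `u_i k = k-1` for `k > i`. -/
def uMap (n i : ℕ) : Fin (n + 2) → Fin (n + 1) :=
  fun k => if (k : ℕ) = 0 ∨ (k : ℕ) = i then 0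
    else if h : (k : ℕ) < i ∧ (k : ℕ) < n + 1 then ⟨k, h.2⟩
    else ⟨(k : ℕ) - 1, by omega⟩

/-- The adjacent transposition `t_i : [n] → [n]` exchanging `i` and `i+1`. -/
def tMap (n i : ℕ) : Fin (n + 1) → Fin (n + 1) :=
  fun k => if h : (k : ℕ) = i ∧ i + 1 < n + 1 then ⟨i + 1, h.2⟩
    else if h2 : (k : ℕ) = i + 1 then ⟨i, by omega⟩
    else k

/-- The standard cyclic permutation `z_i : [n] → [n]`:
`k ↦ k+1` for `k ≤ i-1`, `i ↦ 0`, and `k ↦ k` for `k > i`. -/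
def zMap (n i : ℕ) : Fin (n + 1) → Fin (n + 1) :=
  fun k => if (k : ℕ) = i then 0
    else if h : (k : ℕ) < i ∧ (k : ℕ) + 1 < n + 1 then ⟨(k : ℕ) + 1, h.2⟩
    else k

theorem uMap_val (n i : ℕ) (hi : i ≤ n + 1) (k : Fin (n + 2)) :
    (uMap n i k : ℕ) = if (k : ℕ) = 0 ∨ (k : ℕ) = i then 0
      else if (k : ℕ) < i then (k : ℕ) else (k : ℕ) - 1 := by
  unfold uMap
  split_ifs <;> first | rfl | (exfalso; omega)

theorem tMap_zero_val (n : ℕ) (hn : 1 ≤ n) (k : Fin (n + 1)) :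
    (tMap n 0 k : ℕ) = if (k : ℕ) = 0 then 1 else if (k : ℕ) = 1 then 0 else (k : ℕ) := by
  unfold tMap
  split_ifs <;> first | rfl | (exfalso; omega)

/-- `u_j ∘ t_0 ∘ u_i ∘ t_0 = t_0 ∘ u_i ∘ t_0 ∘ u_{j+1}` as maps `[n+2] → [n]`,
for `2 ≤ i ≤ j ≤ n`. -/
theorem u_t_zero_interchange (n i j : ℕ) (h2i : 2 ≤ i) (hij : i ≤ j) (hjn : j ≤ n) :
    uMap n j ∘ tMap (n + 1) 0 ∘ uMap (n + 1) i ∘ tMap (n + 2) 0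
      = tMap n 0 ∘ uMap n i ∘ tMap (n + 1) 0 ∘ uMap (n + 1) (j + 1) := by
  funext k
  apply Fin.ext
  simp only [Function.comp_apply]
  have e1 := tMap_zero_val (n + 2) (by omega) k
  have e2 := uMap_val (n + 1) i (by omega) (tMap (n + 2) 0 k)
  have e3 := tMap_zero_val (n + 1) (by omega) (uMap (n + 1) i (tMap (n + 2) 0 k))
  have e4 := uMap_val n j (by omega) (tMap (n + 1) 0 (uMap (n + 1) i (tMap (n + 2) 0 k)))
  have f1 := uMap_val (n + 1) (j + 1) (by omega) k
  have f2 := tMap_zero_val (n + 1) (by omega) (uMap (n + 1) (j + 1) k)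
  have f3 := uMap_val n i (by omega) (tMap (n + 1) 0 (uMap (n + 1) (j + 1) k))
  have f4 := tMap_zero_val n (by omega) (uMap n i (tMap (n + 1) 0 (uMap (n + 1) (j + 1) k)))
  grind (splits := 30)
end

section
/- Let γ be a multi-index of dimension ≤ n and let 1 ≤ i ≤ n−1. Then u_γ ∘ t_i = t_{i∼γ} ∘ u_{t_i(γ)} as maps [n] → [n−|γ|], where t_i(γ) denotes the multi-index whose underlying set is the image of γ under the transposition t_i (its indices rearranged in increasing order), and where t_{i∼γ} is the identity map of [n−|γ|] if i ∈ γ or i+1 ∈ γ, and otherwise is the transposition t_{i'} of [n−|γ|] with i' = i − #{ j ∈ γ : j < i }. -/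
/-- A function `f : [n] → [m]` is quasi-monotonic if `f 0 = 0` and `f` is strictly
monotonic outside the preimage of `0`. -/
def QuasiMonotonic {n m : ℕ} (f : Fin (n + 1) → Fin (m + 1)) : Prop :=
  f 0 = 0 ∧ ∀ p q : Fin (n + 1), p < q → f p ≠ 0 → f q ≠ 0 → f p < f q

/-- A multi-index of dimension `≤ n`: a strictly increasing sequence of indices
`i_1 < … < i_k` with `1 ≤ i_p ≤ n` for all `p` (its length is `α.length`). -/
def IsMultiIndex (n : ℕ) (α : List ℕ) : Prop :=
  List.Chain' (· < ·) α ∧ ∀ i ∈ α, 1 ≤ i ∧ i ≤ n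

/-- The quasi-codegeneracy `u_α = u_{i_1} ∘ u_{i_2} ∘ ⋯ ∘ u_{i_k} : [n] → [n-k]`
associated to a multi-index `α = (i_1, …, i_k)`; each elementary factor is taken at the
appropriate dimension (`u_{i_k}` is applied first, at the highest dimension). -/
def uComp (n : ℕ) : (α : List ℕ) → α.length ≤ n → Fin (n + 1) → Fin (n - α.length + 1)
  | [], _ => fun k => k
  | i :: rest, h => fun k =>
      Fin.cast (by simp only [List.length_cons] at h ⊢; omega)
        (uMap (n - rest.length - 1) i
          (Fin.cast (by simp only [List.length_cons] at h; omega)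
            (uComp n rest (by simp only [List.length_cons] at h; omega) k)))

/-- The coface `d_α = d_{i_k} ∘ d_{i_{k-1}} ∘ ⋯ ∘ d_{i_1} : [n-k] → [n]`
associated to a multi-index `α = (i_1, …, i_k)`; each elementary factor is taken at the
appropriate dimension (`d_{i_1}` is applied first, at the lowest dimension). -/
def dComp (n : ℕ) : (α : List ℕ) → α.length ≤ n → Fin (n - α.length + 1) → Fin (n + 1)
  | [], _ => fun k => k
  | i :: rest, h => fun k =>
      dComp n rest (by simp only [List.length_cons] at h; omega)
        (Fin.cast (by simp only [List.length_cons] at h; omega)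
          (dMap (n - rest.length - 1) i
            (Fin.cast (by simp only [List.length_cons] at h ⊢; omega) k)))

/-- The transposition `t_i` of natural numbers, exchanging `i` and `i+1`. -/
def tNat (i k : ℕ) : ℕ := if k = i then i + 1 else if k = i + 1 then i else k

lemma aux_filter_len (α : List ℕ) (h : α.Nodup) (k : ℕ) :
    (α.filter (fun j => j < k)).length = Nat.count (· ∈ α) k := by
  rw [Nat.count_eq_card_filter_range, ← List.toFinset_card_of_nodup (h.filter _)]
  congr 1
  ext j
  simp [and_comm]

lemma aux_count_le (p : ℕ → Prop) [DecidablePred p] (a b : ℕ) (h : a ≤ b) :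
    Nat.count p a ≤ Nat.count p b ∧ Nat.count p b ≤ Nat.count p a + (b - a) := by
  induction b, h using Nat.le_induction with
  | base => simp
  | succ m hm ih => rw [Nat.count_succ]; split_ifs <;> omega

lemma aux_count_zero (p : ℕ → Prop) [DecidablePred p] (a : ℕ) (h : ∀ j < a, ¬ p j) :
    Nat.count p a = 0 := by
  induction a with
  | zero => simp
  | succ m ih =>
    rw [Nat.count_succ, if_neg (h m (by omega)), ih (fun j hj => h j (by omega))]

lemma aux_uComp_val (n : ℕ) : ∀ (α : List ℕ) (h : α.length ≤ n), α.Pairwise (· < ·) →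
    (∀ i ∈ α, 1 ≤ i ∧ i ≤ n) → ∀ k : Fin (n + 1),
    (uComp n α h k : ℕ) = if (k : ℕ) ∈ α then 0 else (k : ℕ) - Nat.count (· ∈ α) k := by
  intro α
  induction α with
  | nil => intro h _ _ k; simp [uComp, aux_count_zero]
  | cons i rest ih =>
    intro h hs hb k
    have hnd : (i :: rest).Nodup := hs.imp (fun h => ne_of_lt h)
    rw [List.pairwise_cons] at hs
    obtain ⟨hlt, hs⟩ := hs
    have hnd' : rest.Nodup := hs.imp (fun h => ne_of_lt h)
    have hv := ih (by simp only [List.length_cons] at h; omega) hs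
      (fun j hj => hb j (List.mem_cons_of_mem _ hj)) k
    have hi := hb i (by simp)
    have hc0 : ∀ j ≤ i + 1, Nat.count (· ∈ rest) j = 0 := by
      intro j hj
      apply aux_count_zero
      intro l hl hm
      have := hlt l hm
      omega
    have hlen : rest.length + i ≤ n := by
      have h1 := aux_filter_len rest hnd' (n + 1)
      rw [List.filter_eq_self.2 (by
        intro j hj
        have := hb j (List.mem_cons_of_mem _ hj)
        simp; omega)] at h1
      have h2 := (aux_count_le (· ∈ rest) (i + 1) (n + 1) (by omega)).2
      have := hc0 (i + 1) le_rfl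
      omega
    have hcc : Nat.count (· ∈ i :: rest) k
        = Nat.count (· ∈ rest) k + if i < (k : ℕ) then 1 else 0 := by
      rw [← aux_filter_len _ hnd, ← aux_filter_len _ hnd', List.filter_cons]
      by_cases hik : i < (k : ℕ) <;> simp [hik]
    rw [hcc]
    have hir : i ∉ rest := fun hm => lt_irrefl _ (hlt i hm)
    simp only [uComp, uMap, Fin.val_cast]
    rw [apply_ite Fin.val, apply_dite Fin.val]
    simp only [Fin.val_cast, Fin.val_zero, List.mem_cons, hv]
    by_cases hkr : (k : ℕ) ∈ rest
    · simp [hkr]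
    · simp only [hkr, if_false, or_false]
      rcases lt_trichotomy (k : ℕ) i with hki | hki | hki
      · have := hc0 k (by omega)
        rw [this]
        split_ifs <;> omega
      · have := hc0 k (by omega)
        rw [this]
        split_ifs <;> omega
      · have := (aux_count_le (· ∈ rest) (i + 1) k (by omega)).2
        have := hc0 (i + 1) le_rfl
        split_ifs <;> omega

lemma aux_tMap_val (n i : ℕ) (h : i + 1 ≤ n) (k : Fin (n + 1)) :
    (tMap n i k : ℕ) = tNat i k := by
  unfold tMap tNat
  split_ifs <;> first | rfl | omega

/-- `u_γ ∘ t_i = t_{i∼γ} ∘ u_{t_i(γ)}` as maps `[n] → [n-|γ|]` for a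
multi-index `γ` of dimension `≤ n` and `1 ≤ i ≤ n-1`.  Here `γ'` is the multi-index
`t_i(γ)` whose underlying set is the image of `γ` under the transposition `t_i`
(characterized by `k ∈ γ' ↔ t_i k ∈ γ`, with indices in increasing order), and
`t_{i∼γ}` is the identity of `[n-|γ|]` if `i ∈ γ` or `i+1 ∈ γ`, and otherwise the
transposition `t_{i'}` of `[n-|γ|]` with `i' = i - #{j ∈ γ | j < i}`. -/
theorem uComp_comp_t (n : ℕ) (γ : List ℕ) (hmi : IsMultiIndex n γ)
    (hγl : γ.length ≤ n) (i : ℕ) (hi1 : 1 ≤ i) (hi2 : i + 1 ≤ n)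
    (γ' : List ℕ) (hmi' : IsMultiIndex n γ') (hγ'l : γ'.length ≤ n)
    (hlen : γ'.length = γ.length)
    (hmem : ∀ k : ℕ, k ∈ γ' ↔ tNat i k ∈ γ) :
    uComp n γ hγl ∘ tMap n i
      = (if i ∈ γ ∨ i + 1 ∈ γ then id
          else tMap (n - γ.length) (i - (γ.filter (fun j => j < i)).length))
        ∘ (fun x : Fin (n + 1) => Fin.cast (by omega) (uComp n γ' hγ'l x)) := by
  have hs : γ.Pairwise (· < ·) := List.isChain_iff_pairwise.1 hmi.1
  have hs' : γ'.Pairwise (· < ·) := List.isChain_iff_pairwise.1 hmi'.1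
  have hnd : γ.Nodup := hs.imp (fun h => ne_of_lt h)
  have h0 : 0 ∉ γ := fun h => by have := hmi.2 0 h; omega
  have hv := aux_uComp_val n γ hγl hs hmi.2
  have hv' := aux_uComp_val n γ' hγ'l hs' hmi'.2
  rw [aux_filter_len γ hnd]
  -- comparison of the counting functions
  have hsucc : ∀ k, Nat.count (· ∈ γ) (k + 1)
      = Nat.count (· ∈ γ) k + if k ∈ γ then 1 else 0 := fun k => Nat.count_succ _ _
  have hsucc' : ∀ k, Nat.count (· ∈ γ') (k + 1)
      = Nat.count (· ∈ γ') k + if tNat i k ∈ γ then 1 else 0 := fun k => by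
    rw [Nat.count_succ]; simp only [hmem]
  have hle : ∀ a b, a ≤ b → Nat.count (· ∈ γ) a ≤ Nat.count (· ∈ γ) b ∧
      Nat.count (· ∈ γ) b ≤ Nat.count (· ∈ γ) a + (b - a) :=
    fun a b h => aux_count_le _ a b h
  have hz : Nat.count (· ∈ γ) 0 = 0 := Nat.count_zero _
  have hz' : Nat.count (· ∈ γ') 0 = 0 := Nat.count_zero _
  generalize Nat.count (· ∈ γ) = C at *
  generalize Nat.count (· ∈ γ') = C' at *
  have hti : tNat i i = i + 1 := by simp [tNat]
  have hti1 : tNat i (i + 1) = i := by simp [tNat]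
  have hto : ∀ k, k ≠ i → k ≠ i + 1 → tNat i k = k := fun k h1 h2 => by simp [tNat, h1, h2]
  have hlow : ∀ k ≤ i, C' k = C k := by
    intro k
    induction k with
    | zero => intro _; omega
    | succ m ih =>
      intro hm
      rw [hsucc, hsucc', ih (by omega), hto m (by omega) (by omega)]
  have h2 : C' (i + 2) = C (i + 2) := by
    have := hlow i le_rfl
    have e1 := hsucc i
    have e2 := hsucc (i + 1)
    have e3 := hsucc' i
    have e4 := hsucc' (i + 1)
    rw [hti] at e3
    rw [hti1] at e4
    show C' (i + 1 + 1) = C (i + 1 + 1)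
    omega
  have hhigh : ∀ k, i + 2 ≤ k → C' k = C k := by
    intro k hk
    induction k, hk using Nat.le_induction with
    | base => exact h2
    | succ m hm ih => rw [hsucc, hsucc', ih, hto m (by omega) (by omega)]
  have hC1 : C 1 = 0 := by have : C 1 = C 0 + if 0 ∈ γ then 1 else 0 := hsucc 0
                           simp only [h0, if_false] at this; omega
  have hCi := hle 1 i hi1
  have e1 := hsucc i
  have e3 := hsucc' i
  rw [hti] at e3
  have hl := hlow i le_rfl
  funext x
  apply Fin.ext
  have hvx := hv (tMap n i x)
  rw [aux_tMap_val n i hi2] at hvx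
  have hvx' := hv' x
  simp only [hmem] at hvx'
  simp only [Function.comp_apply]
  rw [hvx]
  split_ifs with hmx hor hor
  · simp only [id, Fin.val_cast]
    rw [hvx', if_pos hmx]
  · rw [if_pos hmx] at hvx'
    push Not at hor
    have hbd : i - C i + 1 ≤ n - γ.length := by
      have h := hv ⟨i + 1, by omega⟩
      have h' := (uComp n γ hγl ⟨i + 1, by omega⟩).isLt
      simp only [hor.2, if_false] at h
      simp only [hor.1, if_false] at e1
      omega
    rw [aux_tMap_val _ _ hbd]
    simp only [Fin.val_cast]
    rw [hvx']
    unfold tNat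
    split_ifs <;> first | contradiction | omega
  · simp only [id, Fin.val_cast]
    rw [hvx', if_neg hmx]
    by_cases hx : (x : ℕ) = i
    · rw [hx, hti] at hmx ⊢
      have hi : i ∈ γ := by tauto
      simp only [hi, if_true] at e1
      omega
    by_cases hx1 : (x : ℕ) = i + 1
    · rw [hx1, hti1] at hmx ⊢
      have hi : i + 1 ∈ γ := by tauto
      simp only [hi, if_true] at e3
      omega
    rw [hto _ hx hx1] at hmx ⊢
    by_cases hxi : (x : ℕ) ≤ i
    · rw [hlow _ hxi]
    · rw [hhigh _ (by omega)]
  · push Not at hor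
    rw [if_neg hmx] at hvx'
    simp only [hor.1, hor.2, if_false] at e1 e3
    have hbd : i - C i + 1 ≤ n - γ.length := by
      have h := hv ⟨i + 1, by omega⟩
      have h' := (uComp n γ hγl ⟨i + 1, by omega⟩).isLt
      simp only [hor.2, if_false] at h
      omega
    rw [aux_tMap_val _ _ hbd]
    simp only [Fin.val_cast]
    rw [hvx']
    have e2 := hsucc (i + 1)
    simp only [hor.2, if_false] at e2
    by_cases hx : (x : ℕ) = i
    · rw [hx, hti]
      unfold tNat
      split_ifs <;> omega
    by_cases hx1 : (x : ℕ) = i + 1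
    · rw [hx1, hti1]
      unfold tNat
      split_ifs <;> omega
    rw [hto _ hx hx1] at hmx ⊢
    by_cases hxi : (x : ℕ) ≤ i
    · rw [hlow _ hxi]
      have a1 := hsucc x
      simp only [hmx, if_false] at a1
      have a2 := hle (x + 1) i (by omega)
      have a3 := hle 0 x (by omega)
      unfold tNat
      split_ifs <;> omega
    · rw [hhigh _ (by omega)]
      have a2 := hle (i + 1 + 1) x (by omega)
      unfold tNat
      split_ifs <;> omega
end
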